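/- Let s be an odd prime power and P* the plan of Theorem 3.4 on 2s blocks of size (s+1)/2 with two factors over F⁺ = GF(s) ∪ {∞}. Let L₁, L₂ be the factor-versus-block incidence matrices. Then L₁L₂ᵀ = (t+1)(J − I) where t = (s-1)/2, and hence the POTB condition (t+1)·N₁₂ = L₁L₂ᵀ holds. -/

import Mathlib

open scoped Classical

/-- The set of nonzero squares of a finite field. -/
noncomputable def C0F (F : Type*) [Field F] [Fintype F] : Finset F :=
  Finset.univ.filter (fun x => x ≠ 0 ∧ IsSquare x)

/-- Development of a run over `F⁺ = F ∪ {∞}` (with `∞ = none`): add `u` to each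
finite coordinate, `∞ + u = ∞`. -/
def devRun {F : Type*} [Field F] (u : F) (p : Option F × Option F) :
    Option F × Option F :=
  (p.1.map (· + u), p.2.map (· + u))

/-- The initial block `B₀`: columns of `R⁰`, i.e. `(∞, 0)` and `(y, δy)` for `y ∈ C₀`. -/
noncomputable def blk0 (F : Type*) [Field F] [Fintype F] (δ : F) :
    Multiset (Option F × Option F) :=
  ((none, some 0) : Option F × Option F) ::ₘ
    (C0F F).val.map (fun y => (some y, some (δ * y)))

/-- The initial block `B₁`: columns of `R¹`, i.e. `(0, ∞)` and `(y, δ⁻¹y)` for `y ∈ C₀`. -/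
noncomputable def blk1 (F : Type*) [Field F] [Fintype F] (δ : F) :
    Multiset (Option F × Option F) :=
  ((some 0, none) : Option F × Option F) ::ₘ
    (C0F F).val.map (fun y => (some y, some (δ⁻¹ * y)))

/-- The initial block `B₂`: columns of `R²`, i.e. `(0, ∞)` and `(δ⁻¹y, y)` for `y ∈ C₀`. -/
noncomputable def blk2 (F : Type*) [Field F] [Fintype F] (δ : F) :
    Multiset (Option F × Option F) :=
  ((some 0, none) : Option F × Option F) ::ₘ
    (C0F F).val.map (fun y => (some (δ⁻¹ * y), some y))

/-- All runs of the plan `P* = P₀ ⊕ F` of Theorem 3.4: the pair of initial blocks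
(`B₀, B₁` if `t` even; `B₀, B₂` if `t` odd) developed over `F`. -/
noncomputable def totalRuns (F : Type*) [Field F] [Fintype F] (δ : F) (t : ℕ) :
    Multiset (Option F × Option F) :=
  Finset.univ.val.bind (fun u : F =>
    (blk0 F δ).map (devRun u)
      + ((if Even t then blk1 F δ else blk2 F δ)).map (devRun u))

/-- The multiset of runs of the block of `P*` indexed by `(i, u) ∈ Fin 2 × F`. -/
noncomputable def blockRuns (F : Type*) [Field F] [Fintype F] (δ : F) (t : ℕ)
    (i : Fin 2) (u : F) : Multiset (Option F × Option F) :=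
  (if i = 0 then blk0 F δ else if Even t then blk1 F δ else blk2 F δ).map (devRun u)

/-- Factor-versus-block incidence matrices of `P*`. -/
noncomputable def Lmat (F : Type*) [Field F] [Fintype F] (δ : F) (t : ℕ)
    (i : Fin 2) (p : Option F) (j : Fin 2 × F) : ℕ :=
  (blockRuns F δ t j.1 j.2).countP
    (fun r => (if i = 0 then r.1 else r.2) = p)

section POTB

variable {F : Type*} [Field F] [Fintype F]

/-- The `ℕ`-valued indicator of the nonzero squares. -/
noncomputable def sqInd (x : F) : ℕ := if x ∈ C0F F then 1 else 0

/-- The runs `(αy, βy)` for `y` a nonzero square. -/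
noncomputable def linRuns (α β : F) : Multiset (Option F × Option F) :=
  (C0F F).val.map (fun y => (some (α * y), some (β * y)))

theorem sqInd_zero : sqInd (0 : F) = 0 := by simp [sqInd, C0F]

theorem two_mul_sqInd (x : F) :
    2 * (sqInd x : ℤ) = quadraticChar F x ^ 2 + quadraticChar F x := by
  rcases eq_or_ne x 0 with rfl | hx
  · simp [sqInd_zero]
  · by_cases h : IsSquare x
    · simp [sqInd, C0F, hx, h, (quadraticChar_one_iff_isSquare hx).2 h]
    · have : quadraticChar F x = -1 := quadraticChar_neg_one_iff_not_isSquare.2 h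
      simp [sqInd, C0F, h, this]

theorem sqInd_congr {x y : F} (h : quadraticChar F x = quadraticChar F y) :
    sqInd x = sqInd y := by
  have hx := two_mul_sqInd x
  have hy := two_mul_sqInd y
  rw [h] at hx
  omega

theorem quadraticChar_inv (x : F) : quadraticChar F x⁻¹ = quadraticChar F x := by
  rcases eq_or_ne x 0 with rfl | hx
  · simp
  · have h1 : quadraticChar F x⁻¹ * quadraticChar F x = 1 := by
      rw [← map_mul, inv_mul_cancel₀ hx, map_one]
    have h2 := quadraticChar_sq_one hx
    linear_combination quadraticChar F x * h1 - quadraticChar F x⁻¹ * h2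

theorem card_filter_affine {α : F} (hα : α ≠ 0) (a u : F) (Q : F → Prop) :
    ((C0F F).filter (fun y => α * y + u = a ∧ Q y)).card
      = if Q (α⁻¹ * (a - u)) then sqInd (α * (a - u)) else 0 := by
  have h : ∀ y, (α * y + u = a ∧ Q y) ↔ (y = α⁻¹ * (a - u) ∧ Q (α⁻¹ * (a - u))) := by
    intro y
    have : α * y + u = a ↔ y = α⁻¹ * (a - u) := by
      rw [eq_inv_mul_iff_mul_eq₀ hα, eq_sub_iff_add_eq]
    rw [this]
    exact ⟨fun ⟨h, h'⟩ => ⟨h, h ▸ h'⟩, fun ⟨h, h'⟩ => ⟨h, h ▸ h'⟩⟩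
  have hS : sqInd (α * (a - u)) = sqInd (α⁻¹ * (a - u)) :=
    sqInd_congr (by rw [map_mul, map_mul, quadraticChar_inv])
  rw [hS, Finset.card_filter]
  simp only [h]
  by_cases hQ : Q (α⁻¹ * (a - u)) <;> simp [hQ, sqInd]

theorem countP_fst_linRuns {α : F} (hα : α ≠ 0) (β u : F) (p : Option F) :
    ((linRuns α β).map (devRun u)).countP (fun r => r.1 = p)
      = p.elim 0 (fun a => sqInd (α * (a - u))) := by
  rw [linRuns, Multiset.map_map, Multiset.countP_map]
  cases p with
  | none => simp [devRun]
  | some a => simpa [devRun, Finset.card_def] using card_filter_affine hα a u (fun _ => True)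

theorem countP_snd_linRuns {β : F} (hβ : β ≠ 0) (α u : F) (p : Option F) :
    ((linRuns α β).map (devRun u)).countP (fun r => r.2 = p)
      = p.elim 0 (fun a => sqInd (β * (a - u))) := by
  rw [linRuns, Multiset.map_map, Multiset.countP_map]
  cases p with
  | none => simp [devRun]
  | some a => simpa [devRun, Finset.card_def] using card_filter_affine hβ a u (fun _ => True)

theorem count_some_linRuns {α : F} (hα : α ≠ 0) (β u a b : F) :
    ((linRuns α β).map (devRun u)).count (some a, some b)
      = if β * (α⁻¹ * (a - u)) + u = b then sqInd (α * (a - u)) else 0 := by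
  rw [linRuns, Multiset.map_map, Multiset.count, Multiset.countP_map,
    ← card_filter_affine hα a u (fun y => β * y + u = b)]
  simp [devRun, eq_comm, Finset.card_def]

theorem count_none_left_linRuns (α β u : F) (q : Option F) :
    ((linRuns α β).map (devRun u)).count (none, q) = 0 := by
  rw [linRuns, Multiset.map_map, Multiset.count_eq_zero]
  simp [devRun]

theorem count_none_right_linRuns (α β u : F) (p : Option F) :
    ((linRuns α β).map (devRun u)).count (p, none) = 0 := by
  rw [linRuns, Multiset.map_map, Multiset.count_eq_zero]
  simp [devRun]

theorem sum_count_some_linRuns {α β : F} (hα : α ≠ 0) (hαβ : α ≠ β) (a b : F) :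
    ∑ u : F, ((linRuns α β).map (devRun u)).count (some a, some b)
      = sqInd ((α - β) * (a - b)) := by
  have hd : α - β ≠ 0 := sub_ne_zero.2 hαβ
  simp only [count_some_linRuns hα]
  have h : ∀ u : F, β * (α⁻¹ * (a - u)) + u = b ↔ u = a - α * (α - β)⁻¹ * (a - b) := by
    intro u
    constructor <;> intro h
    · field_simp at h ⊢
      linear_combination h
    · subst h
      field_simp
      ring
  simp only [h, Finset.sum_ite_eq', Finset.mem_univ, if_true]
  apply sqInd_congr
  have h2 := quadraticChar_sq_one hα
  rw [sub_sub_cancel]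
  simp only [map_mul, quadraticChar_inv]
  linear_combination (quadraticChar F (α - β) * quadraticChar F (a - b)) * h2

theorem sum_comp_sub_sub {M : Type*} [AddCommMonoid M] (f : F → F → M) (a b : F) :
    ∑ u : F, f (a - u) (b - u) = ∑ x : F, f x (x - (a - b)) := by
  refine Fintype.sum_equiv (Equiv.subLeft a) _ _ fun u => ?_
  simp only [Equiv.subLeft_apply]
  congr 1
  ring

theorem quadraticChar_sq_eq (x : F) : quadraticChar F x ^ 2 = 1 - if x = 0 then 1 else 0 := by
  rcases eq_or_ne x 0 with rfl | hx
  · simp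
  · rw [quadraticChar_sq_one hx, if_neg hx, sub_zero]

theorem sum_quadraticChar_mul_sub (hF : ringChar F ≠ 2) {d : F} (hd : d ≠ 0) :
    ∑ x : F, quadraticChar F x * quadraticChar F (x - d) = -1 := by
  have hJ := jacobiSum_nontrivial_inv (quadraticChar_ne_one hF)
  rw [(quadraticChar_isQuadratic F).inv, jacobiSum] at hJ
  have h2 := quadraticChar_sq_one hd
  have h3 := quadraticChar_sq_one (neg_ne_zero.2 (one_ne_zero (α := F)))
  have hsum : ∑ x : F, quadraticChar F x * quadraticChar F (x - d)
      = ∑ y : F, quadraticChar F (-1) * (quadraticChar F y * quadraticChar F (1 - y)) := by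
    symm
    refine Fintype.sum_equiv (Equiv.mulLeft₀ d hd) _ _ fun y => ?_
    have : d * y - d = d * (-1 * (1 - y)) := by ring
    simp only [Equiv.mulLeft₀_apply, this, map_mul]
    linear_combination -(quadraticChar F (-1) * quadraticChar F y * quadraticChar F (1 - y)) * h2
  rw [hsum, ← Finset.mul_sum, hJ]
  linear_combination -h3

theorem four_mul_sum_sqInd_mul_sqInd (hF : ringChar F ≠ 2) {α β : F} (hα : α ≠ 0) (hβ : β ≠ 0)
    {a b : F} (hab : a ≠ b) :
    4 * ∑ u : F, (sqInd (α * (a - u)) : ℤ) * sqInd (β * (b - u))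
      = Fintype.card F - 2 - quadraticChar F α * quadraticChar F (a - b)
        - quadraticChar F β * quadraticChar F (b - a)
        - quadraticChar F α * quadraticChar F β := by
  rw [sum_comp_sub_sub (fun x y => (sqInd (α * x) : ℤ) * sqInd (β * y)),
    ← neg_sub a b]
  have hd : a - b ≠ 0 := sub_ne_zero.2 hab
  generalize a - b = d at hd ⊢
  have h2 := quadraticChar_sq_one hα
  have h3 := quadraticChar_sq_one hβ
  have key : ∀ x : F, 4 * ((sqInd (α * x) : ℤ) * sqInd (β * (x - d)))
      = 1 - (if x = 0 then 1 else 0) - (if x = d then 1 else 0)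
        + quadraticChar F α * quadraticChar F x
        - (if x = d then quadraticChar F α * quadraticChar F d else 0)
        + quadraticChar F β * quadraticChar F (x - d)
        - (if x = 0 then quadraticChar F β * quadraticChar F (-d) else 0)
        + quadraticChar F α * quadraticChar F β
          * (quadraticChar F x * quadraticChar F (x - d)) := by
    intro x
    have e1 := two_mul_sqInd (α * x)
    have e2 := two_mul_sqInd (β * (x - d))
    rw [map_mul, mul_pow, h2, quadraticChar_sq_eq] at e1
    rw [map_mul, mul_pow, h3, quadraticChar_sq_eq, sub_eq_zero] at e2
    have e3 : 4 * ((sqInd (α * x) : ℤ) * sqInd (β * (x - d)))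
      = (2 * sqInd (α * x)) * (2 * sqInd (β * (x - d))) := by ring
    rw [e3, e1, e2]
    rcases eq_or_ne x 0 with rfl | hx
    · simp [hd.symm]
    · rcases eq_or_ne x d with rfl | hxd
      · simp [hx]
      · simp only [hx, hxd, if_false]
        ring
  have hs : ∑ x : F, quadraticChar F (x - d) = 0 := by
    rw [← quadraticChar_sum_zero hF]
    exact Fintype.sum_equiv (Equiv.subRight d) _ _ fun _ => rfl
  rw [Finset.mul_sum, Finset.sum_congr rfl fun x _ => key x]
  simp only [Finset.sum_add_distrib, Finset.sum_sub_distrib, ← Finset.mul_sum,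
    quadraticChar_sum_zero hF, hs, sum_quadraticChar_mul_sub hF hd, Finset.sum_ite_eq',
    Finset.mem_univ, if_true, Finset.sum_const, Finset.card_univ, nsmul_eq_mul]
  ring

theorem sqInd_mul_sqInd_eq_zero {α β : F} (h : quadraticChar F β = -quadraticChar F α) (x : F) :
    sqInd (α * x) * sqInd (β * x) = 0 := by
  have e1 := two_mul_sqInd (α * x)
  have e2 := two_mul_sqInd (β * x)
  rw [map_mul] at e1 e2
  rw [h] at e2
  have e3 : (4 : ℤ) * (sqInd (α * x) * sqInd (β * x)) =
    (2 * sqInd (α * x)) * (2 * sqInd (β * x)) := by ring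
  rw [e1, e2] at e3
  have e4 : (quadraticChar F α * quadraticChar F x) ^ 2 *
      ((quadraticChar F α * quadraticChar F x) ^ 2 - 1) = 0 := by
    rw [← map_mul, quadraticChar_sq_eq]
    split_ifs <;> simp
  have e5 : ((sqInd (α * x) * sqInd (β * x) : ℕ) : ℤ) = 0 := by
    push_cast
    linarith
  exact_mod_cast e5

theorem sum_sqInd (hF : ringChar F ≠ 2) {α : F} (hα : α ≠ 0) (a : F) :
    2 * ∑ u : F, (sqInd (α * (a - u)) : ℤ) = Fintype.card F - 1 := by
  have h2 := quadraticChar_sq_one hα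
  have h : ∑ u : F, (sqInd (α * (a - u)) : ℤ) = ∑ x : F, (sqInd (α * x) : ℤ) :=
    Fintype.sum_equiv (Equiv.subLeft a) _ _ fun _ => rfl
  rw [h, Finset.mul_sum]
  simp only [two_mul_sqInd, map_mul, mul_pow, h2, quadraticChar_sq_eq, Finset.sum_add_distrib,
    ← Finset.mul_sum, quadraticChar_sum_zero hF, Finset.sum_sub_distrib]
  simp

theorem blk0_eq (δ : F) : blk0 F δ = (none, some 0) ::ₘ linRuns 1 δ := by
  simp [blk0, linRuns]

theorem exists_second_block (hF : ringChar F ≠ 2) {δ : F} (hδ : ¬ IsSquare δ) {t : ℕ}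
    (ht : Fintype.card F = 2 * t + 1) :
    ∃ α β : F, α ≠ 0 ∧ β ≠ 0 ∧ α ≠ β
      ∧ (if Even t then blk1 F δ else blk2 F δ) = (some 0, none) ::ₘ linRuns α β
      ∧ quadraticChar F β = -quadraticChar F α
      ∧ quadraticChar F α = quadraticChar F (-1)
      ∧ quadraticChar F (α - β) = -quadraticChar F (1 - δ) := by
  have hδ0 : δ ≠ 0 := by rintro rfl; exact hδ (IsSquare.zero)
  have hχ : quadraticChar F δ = -1 := quadraticChar_neg_one_iff_not_isSquare.2 hδ
  have hδ1 : δ⁻¹ ≠ 1 := fun h => hδ (inv_eq_one.1 h ▸ IsSquare.one)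
  by_cases he : Even t
  · have hm : quadraticChar F (-1) = 1 := by
      rw [quadraticChar_neg_one hF, ZMod.χ₄_nat_one_mod_four]
      obtain ⟨k, rfl⟩ := he
      omega
    refine ⟨1, δ⁻¹, one_ne_zero, inv_ne_zero hδ0, hδ1.symm, ?_, ?_, ?_, ?_⟩
    · simp [he, blk1, linRuns]
    · rw [quadraticChar_inv, hχ, map_one]
    · rw [map_one, hm]
    · have : 1 - δ⁻¹ = δ⁻¹ * (-1 * (1 - δ)) := by field_simp; ring
      rw [this, map_mul, map_mul, quadraticChar_inv, hχ, hm]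
      ring
  · have hm : quadraticChar F (-1) = -1 := by
      rw [quadraticChar_neg_one hF, ZMod.χ₄_nat_three_mod_four]
      obtain ⟨k, rfl⟩ := Nat.not_even_iff_odd.1 he
      omega
    refine ⟨δ⁻¹, 1, inv_ne_zero hδ0, one_ne_zero, hδ1, ?_, ?_, ?_, ?_⟩
    · simp [he, blk2, linRuns]
    · rw [quadraticChar_inv, hχ, map_one, neg_neg]
    · rw [quadraticChar_inv, hχ, hm]
    · have : δ⁻¹ - 1 = δ⁻¹ * (1 - δ) := by field_simp
      rw [this, map_mul, quadraticChar_inv, hχ]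
      ring

end POTB

/-- in the plan `P*` of Theorem 3.4 on `2s` blocks of size `t+1 = (s+1)/2`,
`L₁L₂ᵀ = (t+1)(J − I)`, and hence the POTB condition `(t+1)·N₁₂ = L₁L₂ᵀ` holds. -/
theorem stmt11 (F : Type*) [Field F] [Fintype F] (s t : ℕ)
    (hs : Fintype.card F = s) (hodd : Odd s) (ht : t = (s - 1) / 2)
    (δ : F) (hδ0 : δ ≠ 0) (hδ : ¬ IsSquare δ)
    (p q : Option F) :
    (∑ j : Fin 2 × F, Lmat F δ t 0 p j * Lmat F δ t 1 q j
        = (t + 1) * (if p = q then 0 else 1))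
    ∧ (t + 1) * (totalRuns F δ t).count (p, q)
        = ∑ j : Fin 2 × F, Lmat F δ t 0 p j * Lmat F δ t 1 q j := by
  have hF : ringChar F ≠ 2 := by
    intro h
    have := FiniteField.even_card_of_char_two h
    rw [hs] at this
    obtain ⟨k, rfl⟩ := hodd
    omega
  have hcard : Fintype.card F = 2 * t + 1 := by
    obtain ⟨k, rfl⟩ := hodd
    omega
  have hχ : quadraticChar F δ = -1 := quadraticChar_neg_one_iff_not_isSquare.2 hδ
  have hδ1 : (1 : F) ≠ δ := fun h => hδ (h ▸ IsSquare.one)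
  obtain ⟨α, β, hα, hβ, hαβ, hblk, hβα, hα1, hdiff⟩ := exists_second_block hF hδ hcard
  have first : ∑ j : Fin 2 × F, Lmat F δ t 0 p j * Lmat F δ t 1 q j
      = (t + 1) * (if p = q then 0 else 1) := by
    rw [Fintype.sum_prod_type, Fin.sum_univ_two]
    simp only [Lmat, blockRuns, if_true, one_ne_zero, if_false, hblk, blk0_eq,
      Multiset.map_cons, Multiset.countP_cons, countP_fst_linRuns hα,
      countP_fst_linRuns (one_ne_zero (α := F)), countP_snd_linRuns hβ, countP_snd_linRuns hδ0,
      devRun, Option.map_none, Option.map_some, zero_add]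
    rcases p with _ | a <;> rcases q with _ | b
    · simp
    · have := sum_sqInd hF hδ0 b
      zify
      simp [Finset.sum_add_distrib]
      rw [hcard] at this
      push_cast at this
      linarith
    · have := sum_sqInd hF hα a
      zify
      simp [Finset.sum_add_distrib]
      rw [hcard] at this
      push_cast at this
      linarith
    · have e1 : quadraticChar F δ = -quadraticChar F 1 := by rw [hχ, map_one]
      rcases eq_or_ne a b with rfl | hab
      · have h1 := fun x : F => sqInd_mul_sqInd_eq_zero e1 x
        have h2 := fun x : F => sqInd_mul_sqInd_eq_zero hβα x
        simp only [Option.elim_some, mul_add, add_mul, Finset.sum_add_distrib, h1, h2]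
        simp [sqInd_zero]
      · have h1 := four_mul_sum_sqInd_mul_sqInd hF one_ne_zero hδ0 hab
        have h2 := four_mul_sum_sqInd_mul_sqInd hF hα hβ hab
        have h3 := two_mul_sqInd (a - b)
        have h4 := two_mul_sqInd (β * (b - a))
        have h5 := quadraticChar_sq_one (sub_ne_zero.2 hab)
        have h6 := quadraticChar_sq_one (neg_ne_zero.2 (one_ne_zero (α := F)))
        have h7 : quadraticChar F (b - a) = quadraticChar F (-1) * quadraticChar F (a - b) := by
          rw [← map_mul]; congr 1; ring
        rw [map_mul, hβα, hα1, h7] at h4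
        rw [hα1, hβα, hα1, h7, hcard] at h2
        rw [hχ, h7, hcard, map_one] at h1
        zify
        simp [hab, mul_add, add_mul, Finset.sum_add_distrib]
        simp only [one_mul] at h1
        push_cast at h1 h2
        generalize quadraticChar F (-1) = ε at *
        generalize quadraticChar F (a - b) = χ at *
        linarith [show ε * (ε * χ) = χ by linear_combination χ * h6,
          show (-ε * (ε * χ)) = -χ by linear_combination -χ * h6,
          show (-ε * (ε * χ))^2 = 1 by linear_combination (χ^2 * ε^2 + χ^2) * h6 + h5,
          show ε * ε = 1 by linear_combination h6]
  refine ⟨first, first ▸ ?_⟩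
  congr 1
  simp only [totalRuns, hblk, blk0_eq, Multiset.count_bind, Multiset.count_add,
    Multiset.map_cons, Multiset.count_cons]
  change ∑ u : F, _ = _
  simp only [Finset.sum_add_distrib]
  rcases p with _ | a <;> rcases q with _ | b
  · simp only [count_none_left_linRuns]
    simp [devRun]
  · simp only [count_none_left_linRuns]
    simp [devRun]
  · simp only [count_none_right_linRuns]
    simp [devRun]
  · rw [sum_count_some_linRuns one_ne_zero hδ1, sum_count_some_linRuns hα hαβ]
    have h1 := two_mul_sqInd ((1 - δ) * (a - b))
    have h2 := two_mul_sqInd ((α - β) * (a - b))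
    rw [map_mul] at h1 h2
    rw [hdiff] at h2
    rcases eq_or_ne a b with rfl | hab
    · simp [devRun, sqInd_zero]
    · have h5 := quadraticChar_sq_one (sub_ne_zero.2 hab)
      have h6 := quadraticChar_sq_one (sub_ne_zero.2 hδ1)
      zify
      simp [devRun, hab]
      have h7 : (quadraticChar F (1 - δ) * quadraticChar F (a - b)) ^ 2 = 1 := by
        rw [mul_pow, h5, h6, one_mul]
      rw [neg_mul, neg_sq] at h2
      linarith
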